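/- arXiv:1607.02763 — 3 statements merged into one kernel-verified Lean document; each statement's English description precedes it below -/
import Mathlib

section
/- Let d ≥ 1, R > 0 and let w ∈ ℝ^d with w_i ≠ 0 for all i. Define r̂ ∈ ℝ^d by r̂_i = R·|w_i|^{2/3} / (Σ_{j=1}^d |w_j|^{2/3}). Then r̂ is feasible (r̂_i > 0 and Σ_i r̂_i = R), and for every r ∈ ℝ^d with r_i > 0 for all i and Σ_{i=1}^d r_i = R, one has Σ_{i=1}^d w_i²/r̂_i² ≤ Σ_{i=1}^d w_i²/r_i²; moreover Σ_{i=1}^d w_i²/r̂_i² = (Σ_{j=1}^d |w_j|^{2/3})³ / R². -/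
/-- **Example 2 (standard deviation proportional to inverse of resource).**
For `σ_i(r_i) = 1/r_i` the noise variance along a linear classifier `w` under allocation
`r` is `Σ_i w_i²/r_i²`.  The allocation `r̂_i = R·|w_i|^{2/3} / Σ_j |w_j|^{2/3}` is feasible
and minimizes this variance over all positive allocations summing to `R`, with minimal
value `(Σ_j |w_j|^{2/3})³ / R²`. -/
theorem optimal_allocation_inverse_resource
    (d : ℕ) (hd : 1 ≤ d) (R : ℝ) (hR : 0 < R)
    (w : Fin d → ℝ) (hw : ∀ i, w i ≠ 0)
    (rhat : Fin d → ℝ)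
    (hrhat : ∀ i, rhat i = R * |w i| ^ ((2 : ℝ) / 3) / ∑ j, |w j| ^ ((2 : ℝ) / 3)) :
    ((∀ i, 0 < rhat i) ∧ ∑ i, rhat i = R) ∧
      (∀ r : Fin d → ℝ, (∀ i, 0 < r i) → ∑ i, r i = R →
        ∑ i, (w i) ^ 2 / (rhat i) ^ 2 ≤ ∑ i, (w i) ^ 2 / (r i) ^ 2) ∧
      ∑ i, (w i) ^ 2 / (rhat i) ^ 2 = (∑ j, |w j| ^ ((2 : ℝ) / 3)) ^ 3 / R ^ 2 := by
  have ha : ∀ i, 0 < |w i| ^ ((2 : ℝ) / 3) := fun i =>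
    Real.rpow_pos_of_pos (abs_pos.mpr (hw i)) _
  have ha3 : ∀ i, (w i) ^ 2 = (|w i| ^ ((2 : ℝ) / 3)) ^ 3 := by
    intro i
    rw [← Real.rpow_natCast (|w i| ^ ((2 : ℝ) / 3)) 3, ← Real.rpow_mul (abs_nonneg _)]
    norm_num
  generalize hadef : (fun i => |w i| ^ ((2 : ℝ) / 3)) = a at *
  have hai : ∀ i, |w i| ^ ((2 : ℝ) / 3) = a i := fun i => congrFun hadef i
  simp only [hai] at *
  have hS : 0 < ∑ j, a j := by
    apply Finset.sum_pos (fun i _ => ha i)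
    exact ⟨⟨0, hd⟩, Finset.mem_univ _⟩
  have hsum : ∑ i, a i = ∑ j, a j := rfl
  generalize hSdef : ∑ j, a j = S at *
  have hval : ∑ i, (w i) ^ 2 / (rhat i) ^ 2 = S ^ 3 / R ^ 2 := by
    have h1 : ∀ i, (w i) ^ 2 / (rhat i) ^ 2 = a i * (S ^ 2 / R ^ 2) := by
      intro i
      have := ha i
      rw [ha3, hrhat]
      field_simp
    simp only [h1]
    rw [← Finset.sum_mul, hSdef]
    field_simp
  refine ⟨⟨fun i => ?_, ?_⟩, ?_, hval⟩
  · rw [hrhat]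
    have := ha i
    positivity
  · simp only [hrhat]
    rw [← Finset.sum_div, ← Finset.mul_sum, hSdef]
    field_simp
  · intro r hr hrR
    rw [hval]
    obtain ⟨c, hc⟩ : ∃ c, c = S / R := ⟨_, rfl⟩
    have hc0 : 0 < c := by rw [hc]; positivity
    have h2 : ∀ i, 3 * c ^ 2 * a i - 2 * c ^ 3 * r i ≤ (w i) ^ 2 / (r i) ^ 2 := by
      intro i
      have h3 := ha i
      have h4 := hr i
      rw [ha3, le_div_iff₀ (by positivity)]
      have h5 : 0 ≤ (a i - c * r i) ^ 2 * (a i + 2 * (c * r i)) := by positivity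
      nlinarith [h5]
    calc S ^ 3 / R ^ 2 = ∑ i, (3 * c ^ 2 * a i - 2 * c ^ 3 * r i) := by
          rw [Finset.sum_sub_distrib, ← Finset.mul_sum, ← Finset.mul_sum, hSdef, hrR, hc]
          field_simp
          ring
      _ ≤ _ := Finset.sum_le_sum (fun i _ => h2 i)
end

section
/- Let d ≥ 1 and let E : ℝ^d → ℝ be a function (the clean empirical square loss). Fix l ∈ ℝ, and for w ∈ ℝ^d with w ≠ 0 and l > E(w) define R_unif(w,l) = d·‖w‖₂²/(l − E(w)) and R_opt(w,l) = ‖w‖₁²/(l − E(w)). Suppose w_unif ≠ 0 and w_opt ≠ 0 satisfy l > E(w_unif), l > E(w_opt), and: R_unif(w_unif, l) ≤ R_unif(w, l) for every w ≠ 0 with l > E(w), and R_opt(w_opt, l) ≤ R_opt(w, l) for every w ≠ 0 with l > E(w). Then d·‖w_unif‖₂²/‖w_unif‖₁² ≤ R_unif(w_unif, l)/R_opt(w_opt, l) ≤ d·‖w_opt‖₂²/‖w_opt‖₁². -/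
/-- **Corollary 3 (benefit of jointly optimizing classifier and allocation).**
With `R_unif(w,l) = d‖w‖₂²/(l − E(w))` and `R_opt(w,l) = ‖w‖₁²/(l − E(w))` the budgets
needed for classifier `w` to achieve loss level `l` under uniform resp. optimal resource
allocation, if `w_unif` minimizes `R_unif(·,l)` and `w_opt` minimizes `R_opt(·,l)` (over
nonzero classifiers with `E(w) < l`), then
`d‖w_unif‖₂²/‖w_unif‖₁² ≤ R_unif(w_unif,l)/R_opt(w_opt,l) ≤ d‖w_opt‖₂²/‖w_opt‖₁²`. -/
theorem benefit_of_joint_optimization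
    (d : ℕ) (hd : 1 ≤ d) (E : (Fin d → ℝ) → ℝ) (l : ℝ)
    (wunif wopt : Fin d → ℝ)
    (hwunif : wunif ≠ 0) (hwopt : wopt ≠ 0)
    (hlunif : E wunif < l) (hlopt : E wopt < l)
    (hmin_unif : ∀ w : Fin d → ℝ, w ≠ 0 → E w < l →
      (d : ℝ) * (∑ i, (wunif i) ^ 2) / (l - E wunif) ≤
        (d : ℝ) * (∑ i, (w i) ^ 2) / (l - E w))
    (hmin_opt : ∀ w : Fin d → ℝ, w ≠ 0 → E w < l →
      (∑ i, |wopt i|) ^ 2 / (l - E wopt) ≤ (∑ i, |w i|) ^ 2 / (l - E w)) :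
    (d : ℝ) * (∑ i, (wunif i) ^ 2) / (∑ i, |wunif i|) ^ 2 ≤
        ((d : ℝ) * (∑ i, (wunif i) ^ 2) / (l - E wunif)) /
          ((∑ i, |wopt i|) ^ 2 / (l - E wopt)) ∧
      ((d : ℝ) * (∑ i, (wunif i) ^ 2) / (l - E wunif)) /
          ((∑ i, |wopt i|) ^ 2 / (l - E wopt)) ≤
        (d : ℝ) * (∑ i, (wopt i) ^ 2) / (∑ i, |wopt i|) ^ 2 := by
  have key : ∀ w : Fin d → ℝ, w ≠ 0 → 0 < (∑ i, |w i|) ^ 2 := by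
    intro w hw
    obtain ⟨j, hj⟩ := Function.ne_iff.mp hw
    have h : 0 < ∑ i, |w i| :=
      Finset.sum_pos' (fun i _ => abs_nonneg _) ⟨j, Finset.mem_univ j, abs_pos.mpr hj⟩
    positivity
  have hu := key wunif hwunif
  have ho := key wopt hwopt
  have hlu : 0 < l - E wunif := sub_pos.mpr hlunif
  have hlo : 0 < l - E wopt := sub_pos.mpr hlopt
  have h1 := hmin_opt wunif hwunif hlunif
  have h2 := hmin_unif wopt hwopt hlopt
  have hA : 0 ≤ (d : ℝ) * (∑ i, (wunif i) ^ 2) := by positivity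
  generalize (d : ℝ) * (∑ i, (wunif i) ^ 2) = A at *
  generalize (d : ℝ) * (∑ i, (wopt i) ^ 2) = B at *
  generalize (∑ i, |wunif i|) ^ 2 = P at *
  generalize (∑ i, |wopt i|) ^ 2 = Q at *
  have hQ : 0 < Q / (l - E wopt) := div_pos ho hlo
  constructor
  · have e : A / P = A / (l - E wunif) / (P / (l - E wunif)) := by
      field_simp
    rw [e]
    exact div_le_div_of_nonneg_left (div_nonneg hA hlu.le) hQ h1
  · have e : B / Q = B / (l - E wopt) / (Q / (l - E wopt)) := by
      field_simp
    rw [e]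
    exact div_le_div_of_nonneg_right h2 hQ.le
end

section
/- Let (Ω, ℱ, ℙ) be a probability space, d ≥ 1, ε > 0, B_W ≥ 0, B̃ ≥ 0. Let x̂¹, x̂² : Ω → ℝ^d be random vectors and y : Ω → ℝ a random variable, and assume: 𝔼[‖x̂¹‖₂⁴] ≤ B̃⁴, 𝔼[y²‖x̂¹‖₂²] ≤ B̃², and for every coordinate i, 𝔼[(x̂¹_i)⁴] ≤ B̃⁴ and 𝔼[(x̂²_i)⁴] ≤ B̃⁴. Let w ∈ ℝ^d with ‖w‖₂ ≤ B_W. Then 𝔼[ ‖(⟨w, x̂¹⟩ − y)·x̂¹‖₂² + Σ_{i=1}^d w_i⁴·((x̂²_i)² − (x̂¹_i)²)²/ε² ] ≤ 2·B_W²·B̃⁴ + 2·B̃² + 2·B̃⁴·B_W⁴/ε². -/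
open MeasureTheory

/-- **Gradient second-moment bound (proof of Theorem 6).**
For the stochastic gradient of Algorithm 1, built from two noisy measurements
`x̂¹, x̂²` of the same data point and a label `y`, if `𝔼‖x̂¹‖⁴ ≤ B̃⁴`,
`𝔼[y²‖x̂¹‖²] ≤ B̃²` and `𝔼[(x̂¹_i)⁴] ≤ B̃⁴`, `𝔼[(x̂²_i)⁴] ≤ B̃⁴` for every
coordinate `i`, then for every `w` with `‖w‖₂ ≤ B_W`,
`𝔼[‖(⟨w,x̂¹⟩−y)x̂¹‖² + Σ_i w_i⁴((x̂²_i)²−(x̂¹_i)²)²/ε²]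
  ≤ 2B_W²B̃⁴ + 2B̃² + 2B̃⁴B_W⁴/ε²`. -/
theorem gradient_norm_bound_unknown_disturbance
    {Ω : Type*} [MeasurableSpace Ω] (μ : Measure Ω) [IsProbabilityMeasure μ]
    (d : ℕ) (hd : 1 ≤ d) (ε BW Bt : ℝ) (hε : 0 < ε) (hBW : 0 ≤ BW) (hBt : 0 ≤ Bt)
    (x1 x2 : Ω → Fin d → ℝ) (y : Ω → ℝ)
    (hx1meas : Measurable x1) (hx2meas : Measurable x2) (hymeas : Measurable y)
    (hint1 : Integrable (fun ω => (∑ i, (x1 ω i) ^ 2) ^ 2) μ)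
    (hint2 : Integrable (fun ω => (y ω) ^ 2 * ∑ i, (x1 ω i) ^ 2) μ)
    (hint3 : ∀ i, Integrable (fun ω => (x1 ω i) ^ 4) μ)
    (hint4 : ∀ i, Integrable (fun ω => (x2 ω i) ^ 4) μ)
    (hm4 : ∫ ω, (∑ i, (x1 ω i) ^ 2) ^ 2 ∂μ ≤ Bt ^ 4)
    (hm2 : ∫ ω, (y ω) ^ 2 * (∑ i, (x1 ω i) ^ 2) ∂μ ≤ Bt ^ 2)
    (hc1 : ∀ i, ∫ ω, (x1 ω i) ^ 4 ∂μ ≤ Bt ^ 4)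
    (hc2 : ∀ i, ∫ ω, (x2 ω i) ^ 4 ∂μ ≤ Bt ^ 4)
    (w : Fin d → ℝ) (hw : Real.sqrt (∑ i, (w i) ^ 2) ≤ BW)
    (hint5 : Integrable (fun ω =>
      ((∑ i, w i * x1 ω i) - y ω) ^ 2 * ∑ i, (x1 ω i) ^ 2) μ) :
    ∫ ω, (((∑ i, w i * x1 ω i) - y ω) ^ 2 * (∑ i, (x1 ω i) ^ 2) +
        ∑ i, (w i) ^ 4 * ((x2 ω i) ^ 2 - (x1 ω i) ^ 2) ^ 2 / ε ^ 2) ∂μ ≤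
      2 * BW ^ 2 * Bt ^ 4 + 2 * Bt ^ 2 + 2 * Bt ^ 4 * BW ^ 4 / ε ^ 2 := by
  have hW : ∑ i, (w i) ^ 2 ≤ BW ^ 2 := (Real.sqrt_le_left hBW).mp hw
  have hW4 : ∑ i, (w i) ^ 4 ≤ BW ^ 4 := by
    have h1 : ∑ i, ((w i) ^ 2) ^ 2 ≤ (∑ i, (w i) ^ 2) ^ 2 :=
      Finset.sum_sq_le_sq_sum_of_nonneg (fun i _ => sq_nonneg (w i))
    have h2 : (∑ i, (w i) ^ 2) ^ 2 ≤ (BW ^ 2) ^ 2 :=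
      pow_le_pow_left₀ (Finset.sum_nonneg (fun i _ => sq_nonneg (w i))) hW 2
    have h3 : ∑ i, (w i) ^ 4 = ∑ i, ((w i) ^ 2) ^ 2 :=
      Finset.sum_congr rfl (fun i _ => by ring)
    rw [h3]
    nlinarith
  have hA : Integrable (fun ω => 2 * BW ^ 2 * (∑ i, (x1 ω i) ^ 2) ^ 2) μ := hint1.const_mul _
  have hB : Integrable (fun ω => 2 * ((y ω) ^ 2 * ∑ i, (x1 ω i) ^ 2)) μ := hint2.const_mul _
  have hCi : ∀ i ∈ (Finset.univ : Finset (Fin d)), Integrable (fun ω =>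
      (w i) ^ 4 / ε ^ 2 * ((x2 ω i) ^ 4 + (x1 ω i) ^ 4)) μ :=
    fun i _ => ((hint4 i).add (hint3 i)).const_mul _
  have hC : Integrable (fun ω => ∑ i,
      (w i) ^ 4 / ε ^ 2 * ((x2 ω i) ^ 4 + (x1 ω i) ^ 4)) μ := integrable_finsetSum _ hCi
  have hAB : Integrable (fun ω => 2 * BW ^ 2 * (∑ i, (x1 ω i) ^ 2) ^ 2 +
      2 * ((y ω) ^ 2 * ∑ i, (x1 ω i) ^ 2)) μ := hA.add hB
  have key : ∫ ω, (((∑ i, w i * x1 ω i) - y ω) ^ 2 * (∑ i, (x1 ω i) ^ 2) +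
        ∑ i, (w i) ^ 4 * ((x2 ω i) ^ 2 - (x1 ω i) ^ 2) ^ 2 / ε ^ 2) ∂μ ≤
      ∫ ω, (2 * BW ^ 2 * (∑ i, (x1 ω i) ^ 2) ^ 2 + 2 * ((y ω) ^ 2 * ∑ i, (x1 ω i) ^ 2) +
        ∑ i, (w i) ^ 4 / ε ^ 2 * ((x2 ω i) ^ 4 + (x1 ω i) ^ 4)) ∂μ := by
    apply integral_mono_of_nonneg
    · refine Filter.Eventually.of_forall (fun ω => ?_)
      show (0 : ℝ) ≤ _
      positivity
    · exact hAB.add hC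
    · refine Filter.Eventually.of_forall (fun ω => ?_)
      refine add_le_add ?_ (Finset.sum_le_sum fun i _ => ?_)
      · have hS : 0 ≤ ∑ i, (x1 ω i) ^ 2 := Finset.sum_nonneg (fun i _ => sq_nonneg _)
        have hcs : (∑ i, w i * x1 ω i) ^ 2 ≤ (∑ i, (w i) ^ 2) * ∑ i, (x1 ω i) ^ 2 :=
          Finset.sum_mul_sq_le_sq_mul_sq _ _ _
        have hcs2 := hcs.trans (mul_le_mul_of_nonneg_right hW hS)
        have h4 : ((∑ i, w i * x1 ω i) - y ω) ^ 2 ≤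
            2 * (BW ^ 2 * ∑ i, (x1 ω i) ^ 2) + 2 * (y ω) ^ 2 := by
          nlinarith [sq_nonneg ((∑ i, w i * x1 ω i) + y ω)]
        calc _ ≤ _ := mul_le_mul_of_nonneg_right h4 hS
          _ = _ := by ring
      · rw [mul_div_right_comm]
        refine mul_le_mul_of_nonneg_left ?_ (by positivity)
        have : 0 ≤ (x2 ω i) ^ 2 * (x1 ω i) ^ 2 := by positivity
        nlinarith
  refine key.trans ?_
  rw [integral_add hAB hC, integral_add hA hB, integral_const_mul, integral_const_mul,
    integral_finsetSum _ hCi]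
  have e1 : 2 * BW ^ 2 * ∫ ω, (∑ i, (x1 ω i) ^ 2) ^ 2 ∂μ ≤ 2 * BW ^ 2 * Bt ^ 4 :=
    mul_le_mul_of_nonneg_left hm4 (by positivity)
  have e3 : ∑ i, ∫ ω, (w i) ^ 4 / ε ^ 2 * ((x2 ω i) ^ 4 + (x1 ω i) ^ 4) ∂μ ≤
      2 * Bt ^ 4 * BW ^ 4 / ε ^ 2 := by
    calc _ ≤ ∑ i, (w i) ^ 4 * (2 * Bt ^ 4 / ε ^ 2) := by
          refine Finset.sum_le_sum fun i _ => ?_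
          rw [integral_const_mul, integral_add (hint4 i) (hint3 i)]
          calc _ ≤ (w i) ^ 4 / ε ^ 2 * (Bt ^ 4 + Bt ^ 4) :=
                mul_le_mul_of_nonneg_left (add_le_add (hc2 i) (hc1 i)) (by positivity)
            _ = _ := by ring
      _ = (∑ i, (w i) ^ 4) * (2 * Bt ^ 4 / ε ^ 2) := (Finset.sum_mul _ _ _).symm
      _ ≤ BW ^ 4 * (2 * Bt ^ 4 / ε ^ 2) := mul_le_mul_of_nonneg_right hW4 (by positivity)
      _ = _ := by ring
  linarith
end
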